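/- arXiv:2202.02554 — 3 statements merged into one kernel-verified Lean document; each statement's English description precedes it below -/
import Mathlib

section
/- Let J ≥ 1 be an integer, N = 2J+2, and τ ∈ ℝ. For every real number x satisfying U_{J+1}(x) = cos(2τ)·U_J(x), the real number −2x is an eigenvalue of the matrix H_N(sin 2τ). -/
open Matrix Polynomial

/-- For `N = 2J+2`, the `N × N` complex matrix `H_N(w)` (0-based indices `0,…,N-1`):
`-1` on the sub- and super-diagonal, all diagonal entries zero except the entry
`-i·w` at 0-based position `J` (1-based `J+1`) and `i·w` at 0-based position `J+1`
(1-based `J+2`). -/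
noncomputable def Hmat (J : ℕ) (w : ℂ) : Matrix (Fin (2*J+2)) (Fin (2*J+2)) ℂ :=
  Matrix.of fun k l =>
    if (k : ℕ) + 1 = (l : ℕ) ∨ (l : ℕ) + 1 = (k : ℕ) then -1
    else if k = l then
      if (k : ℕ) = J then -Complex.I * w
      else if (k : ℕ) = J + 1 then Complex.I * w
      else 0
    else 0

/-- The candidate eigenvector: `U_k` on the left half and `c • U_{2J+1-k}` on the right half. -/
noncomputable def chebyshevVec (J : ℕ) (c : ℂ) (x : ℝ) (k : ℤ) : ℂ :=
  if k ≤ J then (((Polynomial.Chebyshev.U ℝ k).eval x : ℝ) : ℂ)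
  else c * (((Polynomial.Chebyshev.U ℝ (2 * J + 1 - k)).eval x : ℝ) : ℂ)

/-- The action of `Hmat` on the restriction of a sequence vanishing at both ends. -/
theorem Hmat_mulVec_apply (J : ℕ) (w : ℂ) (g : ℤ → ℂ) (hg : g (-1) = 0)
    (hg' : g (2 * J + 2) = 0) (k : Fin (2 * J + 2)) :
    (Hmat J w).mulVec (fun l => g (l : ℕ)) k =
      -g ((k : ℕ) - 1) - g ((k : ℕ) + 1) +
        (if (k : ℕ) = J then -Complex.I * w else if (k : ℕ) = J + 1 then Complex.I * w else 0) *
          g (k : ℕ) := by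
  obtain ⟨k, hk⟩ := k
  set d : ℂ := if k = J then -Complex.I * w else if k = J + 1 then Complex.I * w else 0 with hd
  set F : ℕ → ℂ := fun m => (if k + 1 = m then -g m else 0) + (if m + 1 = k then -g m else 0) +
    (if k = m then d * g m else 0) with hF
  have hterm (l : Fin (2 * J + 2)) : Hmat J w ⟨k, hk⟩ l * g (l : ℕ) = F l := by
    simp only [Hmat, Matrix.of_apply, Fin.ext_iff, ← hd, hF]
    split_ifs <;> first | omega | simp_all
  have hsub : ∑ m ∈ Finset.range (2 * J + 2), (if m + 1 = k then -g m else 0) =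
      -g ((k : ℤ) - 1) := by
    rcases k with _ | k
    · simp [hg]
    · simp [show k < 2 * J + 2 by omega]
  have hsup : ∑ m ∈ Finset.range (2 * J + 2), (if k + 1 = m then -g m else 0) =
      -g ((k : ℤ) + 1) := by
    rw [Finset.sum_ite_eq]
    split_ifs with h
    · simp
    · have : (k : ℤ) + 1 = 2 * J + 2 := by simp at h; omega
      simp [this, hg']
  simp only [Matrix.mulVec, dotProduct, hterm]
  rw [Fin.sum_univ_eq_sum_range, hF, Finset.sum_add_distrib, Finset.sum_add_distrib, hsub, hsup,
    Finset.sum_ite_eq, if_pos (by simpa using hk)]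
  ring

/-- For every real `x` satisfying the secular equation `U_{J+1}(x) = cos(2τ)·U_J(x)`,
the real number `−2x` is an eigenvalue of `H_N(sin 2τ)` (`N = 2J+2`). -/
theorem stmt4 (J : ℕ) (hJ : 1 ≤ J) (τ x : ℝ)
    (hx : (Polynomial.Chebyshev.U ℝ ((J : ℤ) + 1)).eval x =
      Real.cos (2*τ) * (Polynomial.Chebyshev.U ℝ (J : ℤ)).eval x) :
    ∃ v : Fin (2*J+2) → ℂ, v ≠ 0 ∧
      (Hmat J ((Real.sin (2*τ) : ℝ) : ℂ)).mulVec v = ((-2*x : ℝ) : ℂ) • v := by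
  set w : ℂ := ((Real.sin (2 * τ) : ℝ) : ℂ) with hw
  set a : ℂ := ((Real.cos (2 * τ) : ℝ) : ℂ) with ha
  have haw : a ^ 2 + w ^ 2 = 1 := by
    rw [ha, hw]
    exact_mod_cast Real.cos_sq_add_sin_sq (2 * τ)
  set u : ℤ → ℂ := fun k => (((Polynomial.Chebyshev.U ℝ k).eval x : ℝ) : ℂ) with hu
  have hrec (k : ℤ) : u (k + 1) = 2 * x * u k - u (k - 1) := by
    simp only [hu, Polynomial.Chebyshev.U_add_one ℝ k, eval_sub, eval_mul, eval_X, eval_ofNat]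
    push_cast
    ring
  have hsec : u ((J : ℤ) + 1) = a * u J := by
    simp only [hu, ha, hx]
    push_cast
    ring
  set c : ℂ := a - Complex.I * w with hc
  set g := chebyshevVec J c x with hg
  have hleft {k : ℤ} (h : k ≤ J) : g k = u k := if_pos h
  have hright {k : ℤ} (h : (J : ℤ) < k) : g k = c * u (2 * J + 1 - k) := if_neg (by omega)
  have hbot : g (-1) = 0 := by
    rw [hleft (by omega)]
    simp [hu]
  have htop : g (2 * J + 2) = 0 := by
    rw [hright (by omega), show (2 * J + 1 - (2 * J + 2) : ℤ) = -1 by ring]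
    simp [hu]
  refine ⟨fun l => g (l : ℕ), fun h => ?_, ?_⟩
  · have h0 := congrFun h 0
    rw [Pi.zero_apply, hleft (by simp)] at h0
    simp [hu] at h0
  ext ⟨k, hk⟩
  rw [Hmat_mulVec_apply J w g hbot htop]
  simp only [Pi.smul_apply, smul_eq_mul]
  push_cast
  rcases lt_trichotomy k J with h | h | h
  · rw [if_neg (by omega), if_neg (by omega), hleft (by omega), hleft (by omega),
      hleft (by omega), hrec]
    ring
  · subst h
    rw [if_pos rfl, hleft (by omega), hright (by omega), hleft le_rfl,
      show (2 * k + 1 - (k + 1) : ℤ) = k by ring]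
    linear_combination -hrec k + hsec - u k * hc
  · rcases (show J + 1 ≤ k from h).eq_or_lt with h | h
    · subst h
      have h1 := hrec J
      rw [if_neg (by omega), if_pos rfl, hleft (by push_cast; omega), hright (by push_cast; omega),
        hright (by push_cast; omega)]
      push_cast
      rw [show ((J : ℤ) + 1 - 1) = J by ring, show (2 * J + 1 - (J + 1 + 1) : ℤ) = J - 1 by ring,
        show (2 * J + 1 - (J + 1) : ℤ) = J by ring]
      linear_combination -c * h1 + c * hsec + u J * haw + u J * (a + Complex.I * w) * hc -
        u J * w ^ 2 * Complex.I_sq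
    · have h1 := hrec (2 * J + 1 - k)
      rw [if_neg (by omega), if_neg (by omega), hright (by omega), hright (by omega),
        hright (by omega), show (2 * J + 1 - (k - 1) : ℤ) = 2 * J + 1 - k + 1 by ring,
        show (2 * J + 1 - (k + 1) : ℤ) = 2 * J + 1 - k - 1 by ring]
      linear_combination -c * h1
end

section
/- For every integer J ≥ 1, N = 2J+2, and every w ∈ ℂ, the characteristic polynomial of H_N(w) satisfies the identity det(X·I − H_N(w)) = U_{J+1}(−X/2)² − (1 − w²)·U_J(−X/2)² in the polynomial ring ℂ[X], where U_k(−X/2) denotes the composition of the Chebyshev polynomial U_k with the polynomial −X/2. -/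
open Matrix Polynomial

/-- The `n × n` tridiagonal matrix with diagonal `d 0, …, d (n - 1)` and off-diagonal entries `1`. -/
def unitTridiagonal {R : Type*} [CommRing R] (d : ℕ → R) (n : ℕ) : Matrix (Fin n) (Fin n) R :=
  Matrix.of fun k l =>
    if (k : ℕ) + 1 = (l : ℕ) ∨ (l : ℕ) + 1 = (k : ℕ) then 1 else if k = l then d k else 0

section

variable {R : Type*} [CommRing R]

theorem unitTridiagonal_submatrix_succ (d : ℕ → R) (n : ℕ) :
    (unitTridiagonal d (n + 1)).submatrix Fin.succ Fin.succ =
      unitTridiagonal (fun i => d (i + 1)) n := by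
  ext i j
  simp [unitTridiagonal]

theorem det_unitTridiagonal_add_two (d : ℕ → R) (n : ℕ) :
    (unitTridiagonal d (n + 2)).det =
      d 0 * (unitTridiagonal (fun i => d (i + 1)) (n + 1)).det -
        (unitTridiagonal (fun i => d (i + 2)) n).det := by
  have hminor : ((unitTridiagonal d (n + 2)).submatrix Fin.succ (Fin.succAbove 1)).det =
      (unitTridiagonal (fun i => d (i + 2)) n).det := by
    rw [det_succ_column_zero, Fin.sum_univ_succ, Finset.sum_eq_zero]
    · have hsub : ((unitTridiagonal d (n + 2)).submatrix Fin.succ (Fin.succAbove 1)).submatrix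
          (Fin.succAbove 0) Fin.succ = unitTridiagonal (fun i => d (i + 2)) n := by
        ext i j
        simp [unitTridiagonal]
      rw [hsub]
      simp [unitTridiagonal]
    · intro i _
      simp [unitTridiagonal]
  rw [det_succ_row_zero, Fin.sum_univ_succ, Fin.sum_univ_succ, Finset.sum_eq_zero]
  · simp only [Fin.succAbove_zero, unitTridiagonal_submatrix_succ, Fin.succ_zero_eq_one, hminor]
    simp [unitTridiagonal, sub_eq_add_neg]
  · intro i _
    simp [unitTridiagonal, Fin.ext_iff]

theorem det_unitTridiagonal_const (x : R) (n : ℕ) :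
    (unitTridiagonal (fun _ => x) n).det = (Chebyshev.S R n).eval x := by
  induction n using Nat.twoStepInduction with
  | zero => simp
  | one => simp [unitTridiagonal]
  | more n ih₀ ih₁ =>
    rw [det_unitTridiagonal_add_two, ih₀, ih₁]
    push_cast
    simp [Chebyshev.S_add_two]

theorem det_unitTridiagonal_add (x : R) (n k : ℕ) (d : ℕ → R) (hd : ∀ i < k, d i = x) :
    (unitTridiagonal d (n + 1 + k)).det =
      (Chebyshev.S R k).eval x * (unitTridiagonal (fun i => d (i + k)) (n + 1)).det -
        (Chebyshev.S R ((k : ℤ) - 1)).eval x *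
          (unitTridiagonal (fun i => d (i + (k + 1))) n).det := by
  induction k using Nat.twoStepInduction generalizing d with
  | zero => simp
  | one => simp [det_unitTridiagonal_add_two, hd 0]
  | more k ih₀ ih₁ =>
    rw [show n + 1 + (k + 2) = n + 1 + k + 2 by omega, det_unitTridiagonal_add_two,
      show n + 1 + k + 1 = n + 1 + (k + 1) by omega,
      ih₁ _ fun i hi => hd (i + 1) (by omega), ih₀ _ fun i hi => hd (i + 2) (by omega),
      hd 0 (by omega)]
    have h₁ : (Chebyshev.S R ((k : ℤ) + 2)).eval x =
        x * (Chebyshev.S R ((k : ℤ) + 1)).eval x - (Chebyshev.S R (k : ℤ)).eval x := by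
      simp [Chebyshev.S_add_two]
    have h₂ : (Chebyshev.S R ((k : ℤ) + 1)).eval x =
        x * (Chebyshev.S R (k : ℤ)).eval x - (Chebyshev.S R ((k : ℤ) - 1)).eval x := by
      simp [Chebyshev.S_add_one]
    push_cast
    simp only [add_assoc, add_sub_cancel_right, show (k : ℤ) + 2 - 1 = k + 1 by ring]
    simp only [show k + (1 + 1) = k + 2 by rfl, show k + (1 + 2) = k + 3 by rfl]
    rw [h₁, h₂]
    ring

end

theorem Chebyshev_U_comp_neg_half (n : ℕ) :
    (Chebyshev.U ℂ (n : ℤ)).comp (-(C (2⁻¹ : ℂ) * X)) =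
      (-1) ^ n * (Chebyshev.S ℂ[X] (n : ℤ)).eval X := by
  have h2 : (2 : ℂ[X]) * C (2⁻¹ : ℂ) = 1 := by
    rw [show (2 : ℂ[X]) = C 2 from rfl, ← C_mul]
    norm_num
  induction n using Nat.twoStepInduction with
  | zero => simp
  | one =>
    simp
    linear_combination X * h2
  | more n ih₀ ih₁ =>
    push_cast at ih₁ ⊢
    simp only [Chebyshev.U_add_two, Chebyshev.S_add_two, sub_comp, mul_comp, ih₀, ih₁, eval_sub,
      eval_mul, eval_X, X_comp, ofNat_comp]
    linear_combination (X * (-1) ^ n * (Chebyshev.S ℂ[X] ((n : ℤ) + 1)).eval X) * h2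

theorem charmatrix_Hmat (J : ℕ) (w : ℂ) :
    (Hmat J w).charmatrix = unitTridiagonal
      (fun k => if k = J then X + C (Complex.I * w)
        else if k = J + 1 then X - C (Complex.I * w) else X) (2 * J + 2) := by
  ext1 k l
  rcases eq_or_ne k l with rfl | hkl
  · simp only [charmatrix_apply_eq, Hmat, unitTridiagonal, of_apply]
    split_ifs <;> first | omega | simp
  · simp only [charmatrix_apply_ne _ _ _ hkl, Hmat, unitTridiagonal, of_apply, if_neg hkl]
    split_ifs <;> simp

/-- For every `w ∈ ℂ`, the characteristic polynomial of `H_N(w)` (`N = 2J+2`)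
satisfies `det(X·I − H_N(w)) = U_{J+1}(−X/2)² − (1 − w²)·U_J(−X/2)²` in `ℂ[X]`. -/
theorem stmt5 (J : ℕ) (hJ : 1 ≤ J) (w : ℂ) :
    (Hmat J w).charpoly =
      ((Polynomial.Chebyshev.U ℂ ((J : ℤ) + 1)).comp (-(C (2⁻¹ : ℂ) * X))) ^ 2
        - C (1 - w^2) * ((Polynomial.Chebyshev.U ℂ (J : ℤ)).comp (-(C (2⁻¹ : ℂ) * X))) ^ 2 := by
  obtain ⟨j, rfl⟩ : ∃ j, J = j + 1 := ⟨J - 1, by omega⟩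
  have hU₁ := Chebyshev_U_comp_neg_half (j + 1 + 1)
  have hU₀ := Chebyshev_U_comp_neg_half (j + 1)
  have hS : (Chebyshev.S ℂ[X] ((j : ℤ) + 1 + 1)).eval X =
      X * (Chebyshev.S ℂ[X] ((j : ℤ) + 1)).eval X - (Chebyshev.S ℂ[X] (j : ℤ)).eval X := by
    rw [Chebyshev.S_add_one]
    simp
  have hI : (C Complex.I : ℂ[X]) ^ 2 = -1 := by
    rw [← C_pow, Complex.I_sq]
    simp
  have hsign : ((-1 : ℂ[X]) ^ j) ^ 2 = 1 := by
    rw [← pow_mul, mul_comm, pow_mul]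
    simp
  rw [charpoly, charmatrix_Hmat, show 2 * (j + 1) + 2 = (j + 1 + 1) + 1 + (j + 1) by omega,
    det_unitTridiagonal_add X]
  · rw [det_unitTridiagonal_add_two]
    have e₁ : ∀ i, i + (j + 1 + 1) ≠ j + 1 := by omega
    have e₂ : ∀ i, i + 1 + (j + 1) ≠ j + 1 := by omega
    have e₃ : ∀ i, i + 1 + (j + 1) = j + 1 + 1 ↔ i = 0 := by omega
    have e₄ : ∀ i, i + (j + 1 + 1) = j + 1 + 1 ↔ i = 0 := by omega
    simp only [e₁, e₂, e₃, e₄, if_false, zero_add, if_true]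
    rw [det_unitTridiagonal_add_two]
    simp only [if_true, Nat.add_eq_zero_iff, one_ne_zero, OfNat.ofNat_ne_zero, and_false, if_false,
      det_unitTridiagonal_const]
    push_cast at hU₀ hU₁ ⊢
    rw [hU₀, hU₁, hS]
    simp only [add_sub_cancel_right, C_mul, C_sub, C_pow, C_1]
    generalize (Chebyshev.S ℂ[X] ((j : ℤ) + 1)).eval X = a
    generalize (Chebyshev.S ℂ[X] (j : ℤ)).eval X = b
    linear_combination (-(a ^ 2 * C w ^ 2)) * hI +
      (-((X * a - b) ^ 2 - (1 - C w ^ 2) * a ^ 2)) * hsign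
  · intro i hi
    rw [if_neg (by omega), if_neg (by omega)]
end

section
/- For every integer J ≥ 1, N = 2J+2, and every real number w with |w| > 1, the matrix H_N(w) has no real eigenvalue; that is, the whole spectrum ceases to be real as soon as w leaves the interval [−1,1]. -/
open Matrix Polynomial

/-- The solution of `-y (k + 1) - y (k - 1) = x * y k` with `y 0 = 1`, `y (-1) = 0`. -/
def pathSeq (x : ℝ) : ℕ → ℝ
  | 0 => 1
  | 1 => -x
  | k + 2 => -x * pathSeq x (k + 1) - pathSeq x k

theorem pathSeq_not_both_zero (x : ℝ) (k : ℕ) :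
    ¬ (pathSeq x k = 0 ∧ pathSeq x (k + 1) = 0) := by
  induction k with
  | zero => simp [pathSeq]
  | succ k ih =>
    rintro ⟨h1, h2⟩
    refine ih ⟨?_, h1⟩
    simpa [pathSeq, h1] using h2

theorem eq_mul_pathSeq {x : ℝ} {n : ℕ} {y : ℕ → ℂ} (h1 : 1 ≤ n → y 1 = -x * y 0)
    (h : ∀ k, k + 2 ≤ n → y (k + 2) = -x * y (k + 1) - y k) :
    ∀ k ≤ n, y k = y 0 * pathSeq x k
  | 0, _ => by simp [pathSeq]
  | 1, hk => by
    rw [h1 hk]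
    simp only [pathSeq]
    push_cast
    ring
  | k + 2, hk => by
    rw [h k hk, eq_mul_pathSeq h1 h (k + 1) (by omega), eq_mul_pathSeq h1 h k (by omega)]
    simp only [pathSeq]
    push_cast
    ring

/-- The diagonal entries of `Hmat J w`. -/
noncomputable def diagEntry (J : ℕ) (w : ℂ) (k : ℕ) : ℂ :=
  if k = J then -Complex.I * w else if k = J + 1 then Complex.I * w else 0

theorem Hmat_apply (J : ℕ) (w : ℂ) (k l : Fin (2 * J + 2)) :
    Hmat J w k l = (if (k : ℕ) + 1 = l then -1 else 0) + (if (l : ℕ) + 1 = k then -1 else 0)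
      + if (k : ℕ) = l then diagEntry J w k else 0 := by
  simp only [Hmat, diagEntry, Matrix.of_apply, Fin.ext_iff]
  split_ifs <;> first | omega | simp

theorem Hmat_mulVec (J : ℕ) (w : ℂ) (u : ℕ → ℂ) (k : Fin (2 * J + 2)) :
    (Hmat J w).mulVec (fun l => u l) k =
      (if (k : ℕ) + 1 < 2 * J + 2 then -u (k + 1) else 0)
        + (if 0 < (k : ℕ) then -u (k - 1) else 0) + diagEntry J w k * u k := by
  have hk := k.isLt
  have hpred : ∀ l : ℕ, l + 1 = k ↔ 0 < (k : ℕ) ∧ (k : ℕ) - 1 = l := by omega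
  simp only [Matrix.mulVec, dotProduct, Hmat_apply]
  rw [Fin.sum_univ_eq_sum_range (fun l => ((if (k : ℕ) + 1 = l then -1 else 0)
    + (if l + 1 = k then -1 else 0) + if (k : ℕ) = l then diagEntry J w k else 0) * u l)]
  simp only [add_mul, Finset.sum_add_distrib, ite_mul, zero_mul, hpred, ite_and,
    Finset.sum_ite_eq, Finset.mem_range, hk, if_true]
  by_cases h0 : 0 < (k : ℕ)
  · have : (k : ℕ) - 1 < 2 * J + 2 := by omega
    simp [h0, this]
  · simp [h0]

theorem eq_zero_of_matching {w p q : ℝ} (hw : 1 < |w|) (hpq : ¬ (p = 0 ∧ q = 0)) {a b : ℂ}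
    (h1 : b * p = a * (q - Complex.I * w * p)) (h2 : a * p = b * (q + Complex.I * w * p)) :
    a = 0 ∧ b = 0 := by
  have hw2 : 1 < w ^ 2 := by
    rw [← sq_abs]
    exact one_lt_pow₀ hw two_ne_zero
  have hne : (w ^ 2 - 1) * p ^ 2 + q ^ 2 ≠ 0 := by
    rcases not_and_or.mp hpq with h | h
    · have := mul_pos (sub_pos.mpr hw2) (pow_pos (abs_pos.mpr h) 2)
      rw [sq_abs] at this
      positivity
    · have := mul_nonneg (sub_pos.mpr hw2).le (sq_nonneg p)
      positivity
  have hne' : (((w ^ 2 - 1) * p ^ 2 + q ^ 2 : ℝ) : ℂ) ≠ 0 := by exact_mod_cast hne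
  push_cast at hne'
  constructor
  · refine (mul_eq_zero.mp ?_).resolve_right hne'
    linear_combination (-(q + Complex.I * w * p)) * h1 - p * h2
      + a * w ^ 2 * p ^ 2 * Complex.I_sq
  · refine (mul_eq_zero.mp ?_).resolve_right hne'
    linear_combination (-(q - Complex.I * w * p)) * h2 - p * h1
      + b * w ^ 2 * p ^ 2 * Complex.I_sq

/-- For every real `w` with `|w| > 1`, the matrix `H_N(w)` (`N = 2J+2`) has no real
eigenvalue. -/
theorem stmt7 (J : ℕ) (hJ : 1 ≤ J) (w : ℝ) (hw : 1 < |w|) :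
    ∀ x : ℝ, ¬ ∃ v : Fin (2*J+2) → ℂ, v ≠ 0 ∧
      (Hmat J (w : ℂ)).mulVec v = ((x : ℝ) : ℂ) • v := by
  rintro x ⟨v, hv, hvx⟩
  obtain ⟨u, rfl⟩ : ∃ u : ℕ → ℂ, v = fun l : Fin (2 * J + 2) => u l :=
    ⟨fun k => if h : k < 2 * J + 2 then v ⟨k, h⟩ else 0, by ext l; simp⟩
  have row : ∀ k, k < 2 * J + 2 →
      (if k + 1 < 2 * J + 2 then -u (k + 1) else 0) + (if 0 < k then -u (k - 1) else 0)
        + diagEntry J w k * u k = x * u k := fun k hk => by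
    have := congrFun hvx ⟨k, hk⟩
    rwa [Hmat_mulVec] at this
  have left : ∀ k ≤ J, u k = u 0 * pathSeq x k := by
    refine eq_mul_pathSeq (fun _ => ?_) fun k hk => ?_
    · have := row 0 (by omega)
      simp [diagEntry, show 0 ≠ J by omega] at this
      linear_combination -this
    · have := row (k + 1) (by omega)
      simp [diagEntry, show k + 1 ≠ J by omega, show k ≠ J by omega,
        show k + 1 < 2 * J + 1 by omega] at this
      linear_combination -this
  have right : ∀ k ≤ J, u (2 * J + 1 - k) = u (2 * J + 1) * pathSeq x k := by
    refine eq_mul_pathSeq (y := fun k => u (2 * J + 1 - k)) (fun _ => ?_) fun k hk => ?_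
    · have := row (2 * J + 1) (by omega)
      simp [diagEntry, show 2 * J + 1 ≠ J by omega, show 2 * J ≠ J by omega] at this
      simp only [Nat.add_sub_cancel, Nat.sub_zero]
      linear_combination -this
    · have := row (2 * J + 1 - (k + 1)) (by omega)
      rw [if_pos (by omega), if_pos (by omega), diagEntry, if_neg (by omega),
        if_neg (by omega), show 2 * J + 1 - (k + 1) + 1 = 2 * J + 1 - k by omega,
        show 2 * J + 1 - (k + 1) - 1 = 2 * J + 1 - (k + 2) by omega] at this
      linear_combination -this
  obtain ⟨m, rfl⟩ : ∃ m, J = m + 1 := ⟨J - 1, by omega⟩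
  have hl := left (m + 1) le_rfl
  have hl' := left m (by omega)
  have hr := right (m + 1) le_rfl
  have hr' := right m (by omega)
  rw [show 2 * (m + 1) + 1 - (m + 1) = m + 2 by omega] at hr
  rw [show 2 * (m + 1) + 1 - m = m + 3 by omega] at hr'
  have e1 := row (m + 1) (by omega)
  have e2 := row (m + 2) (by omega)
  rw [if_pos (by omega), if_pos (by omega), diagEntry, if_pos rfl, Nat.add_sub_cancel,
    hl, hl', show m + 1 + 1 = m + 2 from rfl, hr] at e1
  rw [if_pos (by omega), if_pos (by omega), diagEntry, if_neg (by omega), if_pos rfl,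
    show m + 2 + 1 = m + 3 from rfl, show m + 2 - 1 = m + 1 from rfl, hl, hr, hr'] at e2
  obtain ⟨ha, hb⟩ := eq_zero_of_matching (a := u 0) (b := u (2 * (m + 1) + 1)) hw
    (pathSeq_not_both_zero x (m + 1))
    (by simp only [pathSeq]; push_cast; linear_combination -e1)
    (by simp only [pathSeq]; push_cast; linear_combination -e2)
  refine hv (funext fun l => ?_)
  change u l = 0
  rcases le_or_gt (l : ℕ) (m + 1) with h | h
  · rw [left l h, ha, zero_mul]
  · have := right (2 * (m + 1) + 1 - l) (by omega)
    rwa [hb, zero_mul, show 2 * (m + 1) + 1 - (2 * (m + 1) + 1 - (l : ℕ)) = l by omega] at this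
end
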